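/- arXiv:2108.03276 — 2 statements merged into one kernel-verified Lean document; each statement's English description precedes it below -/
import Mathlib

section
/- Let x ∈ (−1,1), n ∈ ℕ₀, and N ∈ ℕ with n ≤ 2N−1. Then C_n^{1/2−N}(x) = (2^{N−1} Γ(N+1/2)/√π) (1−x²)^{N/2} ( 𝖯_{n−N}^{−N}(x) + (−1)^n 𝖯_{n−N}^{−N}(−x) ). -/
/-- Pochhammer symbol `(a)_k = a (a+1) ⋯ (a+k-1)` for complex `a`. -/
noncomputable def cpoch (a : ℂ) (k : ℕ) : ℂ := ∏ i ∈ Finset.range k, (a + i)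

/-- Gauss hypergeometric series `₂F₁(a, b; c; z)`. -/
noncomputable def hyp2F1 (a b c z : ℂ) : ℂ :=
  ∑' k : ℕ, cpoch a k * cpoch b k / (cpoch c k * (Nat.factorial k : ℂ)) * z ^ k

/-- Ferrers function of the first kind `𝖯_ν^{−μ}(x)`. -/
noncomputable def ferrersP (ν μ : ℂ) (x : ℝ) : ℂ :=
  (1 / Complex.Gamma (μ + 1)) * (((1 - x) / (1 + x) : ℝ) : ℂ) ^ (μ / 2) *
    hyp2F1 (-ν) (ν + 1) (μ + 1) (((1 - x) / 2 : ℝ) : ℂ)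

/-- Gegenbauer polynomial `C_n^λ(x)`. -/
noncomputable def gegenbauerC (n : ℕ) (lam : ℂ) (x : ℝ) : ℂ :=
  ∑ k ∈ Finset.range (n / 2 + 1),
    (-1) ^ k * cpoch lam (n - k) / ((Nat.factorial k : ℂ) * (Nat.factorial (n - 2 * k) : ℂ)) *
      (2 * (x : ℂ)) ^ (n - 2 * k)

theorem cpoch_succ (a : ℂ) (k : ℕ) : cpoch a (k + 1) = cpoch a k * (a + k) := by
  simp [cpoch, Finset.prod_range_succ]

theorem cpoch_succ' (a : ℂ) (k : ℕ) : cpoch a (k + 1) = a * cpoch (a + 1) k := by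
  rw [cpoch, Finset.prod_range_succ', mul_comm]
  simp only [cpoch, Nat.cast_zero, add_zero, Nat.cast_add, Nat.cast_one]
  congr 1
  exact Finset.prod_congr rfl fun i _ => by ring

theorem cpoch_neg_natCast_eq_zero {m k : ℕ} (h : m < k) : cpoch (-(m : ℂ)) k = 0 :=
  Finset.prod_eq_zero (Finset.mem_range.mpr h) (by simp)

theorem cpoch_natCast_add_one_ne_zero (m k : ℕ) : cpoch ((m : ℂ) + 1) k ≠ 0 := by
  refine Finset.prod_ne_zero_iff.mpr fun i _ => ?_
  exact_mod_cast (by omega : m + 1 + i ≠ 0)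

theorem cpoch_neg_natCast (m k : ℕ) :
    cpoch (-(m : ℂ)) k = (-1) ^ k * (m.choose k) * (k.factorial) := by
  induction k with
  | zero => simp [cpoch]
  | succ k ih =>
    rw [cpoch_succ, ih]
    have h : ((m.choose (k + 1) * (k + 1) : ℕ) : ℂ) = ((m.choose k : ℕ) : ℂ) * ((m : ℂ) - k) := by
      rw [Nat.choose_succ_right_eq]
      rcases le_or_gt k m with hk | hk
      · push_cast [Nat.cast_sub hk]; ring
      · simp [Nat.choose_eq_zero_of_lt hk]
    push_cast [Nat.factorial_succ] at h ⊢
    linear_combination (-(-1) ^ (k + 1)) * (k.factorial : ℂ) * h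

/-- The `k`-th coefficient of `₂F₁(-ν, ν+1; c; z)`. -/
noncomputable def legendreCoeff (ν c : ℂ) (k : ℕ) : ℂ :=
  cpoch (-ν) k * cpoch (ν + 1) k / (cpoch c k * (Nat.factorial k : ℂ))

theorem legendreCoeff_zero (ν c : ℂ) : legendreCoeff ν c 0 = 1 := by
  simp [legendreCoeff, cpoch]

theorem legendreCoeff_eq_zero (ν : ℤ) (c : ℂ) {k : ℕ} (hk : ν.natAbs < k) :
    legendreCoeff ν c k = 0 := by
  rcases le_or_gt 0 ν with h | h
  · lift ν to ℕ using h
    have : cpoch (-((ν : ℤ) : ℂ)) k = 0 := by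
      rw [Int.cast_natCast]
      exact cpoch_neg_natCast_eq_zero (by simpa using hk)
    rw [legendreCoeff, this]; simp
  · obtain ⟨m, rfl⟩ : ∃ m : ℕ, ν = -(m : ℤ) - 1 := ⟨(-ν - 1).toNat, by omega⟩
    have : cpoch (((-(m : ℤ) - 1 : ℤ) : ℂ) + 1) k = 0 := by
      have e : ((-(m : ℤ) - 1 : ℤ) : ℂ) + 1 = -(m : ℂ) := by push_cast; ring
      rw [e]
      exact cpoch_neg_natCast_eq_zero (by omega)
    rw [legendreCoeff, this]; simp

theorem summable_legendreCoeff (ν : ℤ) (c z : ℂ) :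
    Summable fun k => legendreCoeff ν c k * z ^ k :=
  summable_of_ne_finset_zero (s := Finset.range (ν.natAbs + 1)) fun k hk => by
    rw [legendreCoeff_eq_zero ν c (by simpa using hk), zero_mul]

theorem legendreCoeff_contiguous (N : ℕ) (ν : ℂ) (k : ℕ) :
    (ν + N + 1) * legendreCoeff (ν + 1) (N + 1) (k + 1) =
      (2 * ν + 1) * (legendreCoeff ν (N + 1) (k + 1) - 2 * legendreCoeff ν (N + 1) k)
        - (ν - N) * legendreCoeff (ν - 1) (N + 1) (k + 1) := by
  unfold legendreCoeff
  rcases k with _ | j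
  · have h : (N : ℂ) + 1 ≠ 0 := by exact_mod_cast Nat.succ_ne_zero N
    simp only [cpoch, zero_add, Finset.prod_range_one, Finset.prod_range_zero]
    simp
    field_simp
    ring
  · have hc := cpoch_natCast_add_one_ne_zero N j
    have hf : (j.factorial : ℂ) ≠ 0 := by exact_mod_cast j.factorial_ne_zero
    have h1 : (N : ℂ) + 1 + j ≠ 0 := by exact_mod_cast (by omega : N + 1 + j ≠ 0)
    have h2 : (N : ℂ) + 1 + (j + 1) ≠ 0 := by exact_mod_cast (by omega : N + 1 + (j + 1) ≠ 0)
    have h3 : (j : ℂ) + 1 ≠ 0 := by exact_mod_cast (by omega : j + 1 ≠ 0)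
    have h4 : (j : ℂ) + 1 + 1 ≠ 0 := by exact_mod_cast (by omega : j + 1 + 1 ≠ 0)
    have e1 : cpoch (-(ν + 1)) (j + 1 + 1) = (-(ν + 1)) * (-ν * cpoch (1 - ν) j) := by
      rw [cpoch_succ', show -(ν + 1) + 1 = -ν by ring, cpoch_succ', show -ν + 1 = 1 - ν by ring]
    have e2 : cpoch (ν + 1 + 1) (j + 1 + 1) =
        cpoch (ν + 2) j * (ν + 2 + j) * (ν + 2 + (j + 1)) := by
      rw [cpoch_succ, cpoch_succ, show ν + 1 + 1 = ν + 2 by ring]; push_cast; ring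
    have e3 : cpoch (-ν) (j + 1) = -ν * cpoch (1 - ν) j := by
      rw [cpoch_succ', show -ν + 1 = 1 - ν by ring]
    have e4 : cpoch (ν + 1) (j + 1) = (ν + 1) * cpoch (ν + 2) j := by
      rw [cpoch_succ', show ν + 1 + 1 = ν + 2 by ring]
    have e5 : cpoch (-(ν - 1)) (j + 1 + 1) =
        cpoch (1 - ν) j * (1 - ν + j) * (1 - ν + (j + 1)) := by
      rw [cpoch_succ, cpoch_succ, show -(ν - 1) = 1 - ν by ring]; push_cast; ring
    have e6 : cpoch (ν - 1 + 1) (j + 1 + 1) = ν * ((ν + 1) * cpoch (ν + 2) j) := by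
      rw [show ν - 1 + 1 = ν by ring, cpoch_succ', e4]
    rw [e1, e2, e5, e6, cpoch_succ (-ν) (j + 1), cpoch_succ (ν + 1) (j + 1), e3, e4,
      cpoch_succ _ (j + 1), cpoch_succ _ j, Nat.factorial_succ, Nat.factorial_succ]
    generalize cpoch (1 - ν) j = Q
    generalize cpoch (ν + 2) j = R
    push_cast
    field_simp
    ring

/-- The contiguous relation behind the three-term recurrence of the Ferrers functions in their
degree. -/
theorem hyp2F1_contiguous (N : ℕ) (ν : ℤ) (z : ℂ) :
    ((ν : ℂ) + N + 1) * hyp2F1 (-(ν + 1)) (ν + 1 + 1) (N + 1) z =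
      (2 * ν + 1) * (1 - 2 * z) * hyp2F1 (-ν) (ν + 1) (N + 1) z
        - (ν - N) * hyp2F1 (-(ν - 1)) (ν - 1 + 1) (N + 1) z := by
  have s1 := summable_legendreCoeff (ν + 1) (N + 1) z
  have s2 := summable_legendreCoeff ν (N + 1) z
  have s3 := summable_legendreCoeff (ν - 1) (N + 1) z
  push_cast at s1 s3
  have key : ∀ μ : ℂ, hyp2F1 (-μ) (μ + 1) (N + 1) z
      = ∑' k, legendreCoeff μ (N + 1) k * z ^ k := fun μ => rfl
  rw [key, key, key]
  have t2 : (∑' k, legendreCoeff ν (N + 1) (k + 1) * z ^ (k + 1)) =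
      ∑' k, legendreCoeff ν (N + 1) k * z ^ k - 1 := by
    rw [s2.tsum_eq_zero_add, legendreCoeff_zero]; simp
  have h1 := (summable_nat_add_iff 1).mpr s1
  have h2 := (summable_nat_add_iff 1).mpr s2
  have h3 := (summable_nat_add_iff 1).mpr s3
  have e : ∑' k, ((ν : ℂ) + N + 1) * (legendreCoeff (ν + 1) (N + 1) (k + 1) * z ^ (k + 1)) =
      ∑' k, ((2 * ν + 1) * (legendreCoeff ν (N + 1) (k + 1) * z ^ (k + 1))
        - (2 * ν + 1) * (2 * z) * (legendreCoeff ν (N + 1) k * z ^ k)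
        - (ν - N) * (legendreCoeff (ν - 1) (N + 1) (k + 1) * z ^ (k + 1))) :=
    tsum_congr fun k => by
      linear_combination z ^ (k + 1) * legendreCoeff_contiguous N ν k
  rw [((h2.mul_left _).sub (s2.mul_left _)).tsum_sub (h3.mul_left _),
    (h2.mul_left _).tsum_sub (s2.mul_left _), tsum_mul_left, tsum_mul_left, tsum_mul_left,
    tsum_mul_left, t2] at e
  rw [s1.tsum_eq_zero_add, s3.tsum_eq_zero_add, legendreCoeff_zero, legendreCoeff_zero]
  linear_combination e

theorem hyp2F1_self_left (N : ℕ) (z : ℂ) :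
    hyp2F1 (N + 1) (-N) (N + 1) z = (1 - z) ^ N := by
  have h : ∀ k, cpoch (N + 1) k * cpoch (-N) k / (cpoch (N + 1) k * (Nat.factorial k : ℂ)) * z ^ k
      = (-z) ^ k * N.choose k := fun k => by
    have hc := cpoch_natCast_add_one_ne_zero N k
    have hf : (k.factorial : ℂ) ≠ 0 := by exact_mod_cast k.factorial_ne_zero
    rw [cpoch_neg_natCast, neg_pow z]
    field_simp
  rw [hyp2F1, tsum_congr h, tsum_eq_sum (s := Finset.range (N + 1)), sub_eq_neg_add, add_pow]
  · simp
  · intro k hk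
    rw [Nat.choose_eq_zero_of_lt (by simpa using hk)]; simp

/-- The incomplete beta integral with equal positive integer parameters. -/
theorem integral_eq_hyp2F1 (M : ℕ) (y : ℝ) :
    ((M : ℂ) + 1) * ∫ t in (0 : ℝ)..y, (t : ℂ) ^ M * (1 - (t : ℂ)) ^ M =
      (y : ℂ) ^ (M + 1) * hyp2F1 (M + 1) (-M) (M + 1 + 1) y := by
  have h : ∀ t : ℝ, (t : ℂ) ^ M * (1 - (t : ℂ)) ^ M =
      ∑ k ∈ Finset.range (M + 1), ((-1) ^ k * M.choose k : ℂ) * ((t ^ (M + k) : ℝ) : ℂ) := by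
    intro t
    rw [sub_eq_neg_add, add_pow, Finset.mul_sum]
    refine Finset.sum_congr rfl fun k _ => ?_
    rw [neg_pow (t : ℂ)]; push_cast; ring
  simp_rw [h]
  rw [intervalIntegral.integral_finsetSum fun k _ =>
    Continuous.intervalIntegrable (by fun_prop) _ _, hyp2F1,
    tsum_eq_sum (s := Finset.range (M + 1)), Finset.mul_sum, Finset.mul_sum]
  · refine Finset.sum_congr rfl fun k _ => ?_
    rw [intervalIntegral.integral_const_mul, intervalIntegral.integral_ofReal, integral_pow,
      cpoch_neg_natCast]
    have hs := cpoch_succ ((M : ℂ) + 1) k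
    rw [cpoch_succ'] at hs
    have hc : cpoch ((M : ℂ) + 1 + 1) k ≠ 0 := by
      exact_mod_cast cpoch_natCast_add_one_ne_zero (M + 1) k
    have hf : (k.factorial : ℂ) ≠ 0 := by exact_mod_cast k.factorial_ne_zero
    have h1 : (M : ℂ) + k + 1 ≠ 0 := by exact_mod_cast (by omega : M + k + 1 ≠ 0)
    push_cast
    rw [zero_pow (by omega)]
    field_simp
    linear_combination (M.choose k : ℂ) * y ^ (M + 1 + k) * hs
  · intro k hk
    rw [cpoch_neg_natCast_eq_zero (by simpa using hk)]; simp

theorem hyp2F1_add_hyp2F1_one_sub (M : ℕ) (y : ℝ) :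
    (y : ℂ) ^ (M + 1) * hyp2F1 (M + 1) (-M) (M + 1 + 1) y +
      (1 - y : ℂ) ^ (M + 1) * hyp2F1 (M + 1) (-M) (M + 1 + 1) (1 - y) =
      (M + 1) * Complex.betaIntegral (M + 1) (M + 1) := by
  have h := integral_eq_hyp2F1 M (1 - y)
  push_cast at h
  have hsymm : ∫ t in (0 : ℝ)..(1 - y), (t : ℂ) ^ M * (1 - (t : ℂ)) ^ M =
      ∫ t in y..1, (t : ℂ) ^ M * (1 - (t : ℂ)) ^ M := by
    have := intervalIntegral.integral_comp_sub_left (a := y) (b := 1)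
      (fun t : ℝ => (t : ℂ) ^ M * (1 - (t : ℂ)) ^ M) 1
    rw [sub_self] at this
    rw [← this]
    refine intervalIntegral.integral_congr fun t _ => ?_
    simp [mul_comm]
  rw [← integral_eq_hyp2F1, ← h, hsymm, ← mul_add,
    intervalIntegral.integral_add_adjacent_intervals
      (Continuous.intervalIntegrable (by fun_prop) _ _)
      (Continuous.intervalIntegrable (by fun_prop) _ _), Complex.betaIntegral]
  simp

/-- The `k`-th term of `C_n^λ(x)` for `2k ≤ n`, extended by zero. -/
noncomputable def gegenbauerTerm (lam w : ℂ) (n k : ℕ) : ℂ :=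
  if 2 * k ≤ n then
    (-1) ^ k * cpoch lam (n - k) / ((Nat.factorial k : ℂ) * (Nat.factorial (n - 2 * k) : ℂ)) *
      w ^ (n - 2 * k)
  else 0

theorem gegenbauerC_eq_sum {n m : ℕ} (h : n / 2 < m) (lam : ℂ) (x : ℝ) :
    gegenbauerC n lam x = ∑ k ∈ Finset.range m, gegenbauerTerm lam (2 * x) n k := by
  rw [gegenbauerC, ← Finset.sum_subset (Finset.range_subset_range.mpr (Nat.succ_le_of_lt h))]
  · refine Finset.sum_congr rfl fun k hk => ?_
    rw [Finset.mem_range] at hk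
    rw [gegenbauerTerm, if_pos (by omega)]
  · intro k _ hk
    rw [Finset.mem_range] at hk
    rw [gegenbauerTerm, if_neg (by omega)]

theorem gegenbauerTerm_recurrence_zero (lam w : ℂ) (n : ℕ) :
    (n + 1 : ℂ) * gegenbauerTerm lam w (n + 1) 0 = w * (n + lam) * gegenbauerTerm lam w n 0 := by
  have hf : (n.factorial : ℂ) ≠ 0 := by exact_mod_cast n.factorial_ne_zero
  have h1 : (n : ℂ) + 1 ≠ 0 := by exact_mod_cast n.succ_ne_zero
  simp [gegenbauerTerm, cpoch_succ, Nat.factorial_succ]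
  field_simp
  ring

theorem gegenbauerTerm_recurrence_succ (lam w : ℂ) (n j : ℕ) :
    (n + 2 : ℂ) * gegenbauerTerm lam w (n + 2) (j + 1) =
      w * (n + 1 + lam) * gegenbauerTerm lam w (n + 1) (j + 1)
        - (n + 2 * lam) * gegenbauerTerm lam w n j := by
  unfold gegenbauerTerm
  rcases lt_or_ge n (2 * j) with h | h
  · rw [if_neg (by omega), if_neg (by omega), if_neg (by omega)]; ring
  obtain ⟨r, rfl⟩ := Nat.exists_eq_add_of_le h
  have hj : (j.factorial : ℂ) ≠ 0 := by exact_mod_cast j.factorial_ne_zero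
  have hj1 : (j : ℂ) + 1 ≠ 0 := by exact_mod_cast j.succ_ne_zero
  rw [if_pos (by omega), if_pos h, show 2 * j + r + 2 - (j + 1) = j + r + 1 by omega,
    show 2 * j + r + 2 - 2 * (j + 1) = r by omega, show 2 * j + r - j = j + r by omega,
    show 2 * j + r - 2 * j = r by omega, Nat.factorial_succ, cpoch_succ]
  rcases r with _ | s
  · rw [if_neg (by omega)]
    push_cast
    simp only [Nat.factorial_zero, Nat.cast_one]
    field_simp
    ring
  · have hs : (s.factorial : ℂ) ≠ 0 := by exact_mod_cast s.factorial_ne_zero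
    have hs1 : (s : ℂ) + 1 ≠ 0 := by exact_mod_cast s.succ_ne_zero
    rw [if_pos (by omega), show 2 * j + (s + 1) + 1 - (j + 1) = j + (s + 1) by omega,
      show 2 * j + (s + 1) + 1 - 2 * (j + 1) = s by omega, Nat.factorial_succ s]
    push_cast
    field_simp
    ring

theorem gegenbauerC_recurrence (n : ℕ) (lam : ℂ) (x : ℝ) :
    (n + 2 : ℂ) * gegenbauerC (n + 2) lam x =
      2 * x * (n + 1 + lam) * gegenbauerC (n + 1) lam x
        - (n + 2 * lam) * gegenbauerC n lam x := by
  rw [gegenbauerC_eq_sum (m := n + 1 + 1) (by omega),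
    gegenbauerC_eq_sum (m := n + 1 + 1) (by omega),
    gegenbauerC_eq_sum (m := n + 1) (by omega),
    Finset.sum_range_succ' _ (n + 1), Finset.sum_range_succ' _ (n + 1), mul_add, mul_add,
    Finset.mul_sum, Finset.mul_sum, Finset.mul_sum,
    Finset.sum_congr rfl fun j _ => gegenbauerTerm_recurrence_succ lam (2 * x) n j,
    Finset.sum_sub_distrib]
  have h := gegenbauerTerm_recurrence_zero lam (2 * x) (n + 1)
  push_cast at h
  linear_combination h

/-- The combination of hypergeometric functions to which the right-hand side reduces. -/
noncomputable def ferrersPair (N : ℕ) (y : ℂ) (ν : ℤ) (s : ℂ) : ℂ :=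
  y ^ N * hyp2F1 (-ν) (ν + 1) (N + 1) y + s * (1 - y) ^ N * hyp2F1 (-ν) (ν + 1) (N + 1) (1 - y)

theorem ferrersPair_recurrence (N : ℕ) (y : ℂ) (ν : ℤ) (s : ℂ) :
    ((ν : ℂ) + N + 1) * ferrersPair N y (ν + 1) s =
      (2 * ν + 1) * (1 - 2 * y) * ferrersPair N y ν (-s) - (ν - N) * ferrersPair N y (ν - 1) s := by
  unfold ferrersPair
  push_cast
  linear_combination y ^ N * hyp2F1_contiguous N ν y
    + s * (1 - y) ^ N * hyp2F1_contiguous N ν (1 - y)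

theorem ferrersPair_neg_sub_one (N : ℕ) (y : ℂ) : ferrersPair N y (-N - 1) (-1) = 0 := by
  unfold ferrersPair
  push_cast
  rw [show -(-(N : ℂ) - 1) = N + 1 by ring, show -(N : ℂ) - 1 + 1 = -N by ring,
    hyp2F1_self_left, hyp2F1_self_left]
  ring

theorem ferrersPair_neg (M : ℕ) (y : ℝ) :
    ferrersPair (M + 1) y (-(M + 1 : ℕ)) 1 =
      (M + 1) * Complex.betaIntegral (M + 1) (M + 1) := by
  rw [← hyp2F1_add_hyp2F1_one_sub M y, ferrersPair]
  push_cast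
  rw [neg_neg, show -((M : ℂ) + 1) + 1 = -M by ring, one_mul]

theorem gegenbauerC_eq_ferrersPair {N : ℕ} {K : ℂ} {x : ℝ} (y : ℂ) (hy : 1 - 2 * y = x)
    (h0 : K * ferrersPair N y (-N) 1 = 1) (n : ℕ) :
    gegenbauerC n (1 / 2 - (N : ℂ)) x = K * ferrersPair N y (n - N) ((-1) ^ n) := by
  induction n using Nat.twoStepInduction with
  | zero => simp [gegenbauerC, cpoch, h0]
  | one =>
    have h := ferrersPair_recurrence N y (-N) (-1)
    rw [ferrersPair_neg_sub_one, neg_neg, hy, show (-(N : ℤ) + 1) = ((1 : ℕ) : ℤ) - N by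
      push_cast; ring] at h
    have hc : gegenbauerC 1 (1 / 2 - (N : ℂ)) x = (1 / 2 - N) * (2 * x) := by
      simp [gegenbauerC, cpoch]
    rw [hc, pow_one]
    push_cast at h ⊢
    linear_combination (-K) * h - (1 - 2 * N) * x * h0
  | more n ih0 ih1 =>
    have h := ferrersPair_recurrence N y (n + 1 - N) ((-1) ^ n)
    rw [hy, show (n + 1 - N + 1 : ℤ) = n + 2 - N by ring,
      show (n + 1 - N - 1 : ℤ) = n - N by ring] at h
    have hg := gegenbauerC_recurrence n (1 / 2 - N) x
    rw [ih0, ih1, pow_succ] at hg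
    rw [pow_add]
    have hn : (n : ℂ) + 2 ≠ 0 := by exact_mod_cast (by omega : n + 2 ≠ 0)
    apply mul_left_cancel₀ hn
    rw [hg]
    push_cast at h ⊢
    rw [mul_neg_one]
    rw [show (-1 : ℂ) ^ 2 = 1 by norm_num, mul_one]
    linear_combination (-K) * h

theorem one_sub_sq_cpow_mul {x : ℝ} (hx : x ∈ Set.Ioo (-1 : ℝ) 1) (N : ℕ) :
    ((1 - x ^ 2 : ℝ) : ℂ) ^ ((N : ℂ) / 2) * (((1 - x) / (1 + x) : ℝ) : ℂ) ^ ((N : ℂ) / 2) =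
      (1 - x : ℂ) ^ N := by
  have h1 : 0 < 1 - x := by linarith [hx.2]
  have h2 : 0 < 1 + x := by linarith [hx.1]
  have e : ((N : ℂ) / 2) = ((N / 2 : ℝ) : ℂ) := by push_cast; ring
  have h3 : (1 - x ^ 2) * ((1 - x) / (1 + x)) = (1 - x) ^ 2 := by field_simp; ring
  have h4 : 0 ≤ 1 - x ^ 2 := by nlinarith
  rw [e, ← Complex.ofReal_cpow h4, ← Complex.ofReal_cpow (by positivity), ← Complex.ofReal_mul,
    ← Real.mul_rpow h4 (by positivity), h3, ← Real.rpow_natCast, ← Real.rpow_mul h1.le]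
  push_cast
  rw [mul_div_cancel₀ _ (two_ne_zero), Real.rpow_natCast]
  push_cast
  rfl

theorem one_sub_sq_cpow_mul_ferrersP {x : ℝ} (hx : x ∈ Set.Ioo (-1 : ℝ) 1) (N : ℕ) (ν : ℂ) :
    ((1 - x ^ 2 : ℝ) : ℂ) ^ ((N : ℂ) / 2) * ferrersP ν N x =
      2 ^ N / N.factorial *
        (((1 - x) / 2 : ℂ) ^ N * hyp2F1 (-ν) (ν + 1) (N + 1) ((1 - x) / 2)) := by
  have h := one_sub_sq_cpow_mul hx N
  have hd : (2 : ℂ) ^ N * ((1 - x) / 2) ^ N = (1 - x) ^ N := by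
    rw [← mul_pow, mul_div_cancel₀ _ two_ne_zero]
  rw [ferrersP, Complex.Gamma_nat_eq_factorial]
  push_cast at h ⊢
  linear_combination hyp2F1 (-ν) (ν + 1) (N + 1) ((1 - x) / 2) / N.factorial * (h - hd)

theorem gamma_mul_betaIntegral (M : ℕ) :
    (2 : ℂ) ^ M * Complex.Gamma (M + 1 + 1 / 2) / (Real.sqrt Real.pi : ℂ) *
      (2 ^ (M + 1) / (M + 1).factorial) *
        ((M + 1) * Complex.betaIntegral (M + 1) (M + 1)) = 1 := by
  have hre : 0 < ((M : ℂ) + 1).re := by simp; positivity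
  have hb := Complex.Gamma_mul_Gamma_eq_betaIntegral hre hre
  have hd := Complex.Gamma_mul_Gamma_add_half ((M : ℂ) + 1)
  have hG : Complex.Gamma ((M : ℂ) + 1 + (M + 1)) ≠ 0 :=
    Complex.Gamma_ne_zero_of_re_pos (by simp; positivity)
  have hM : (M.factorial : ℂ) ≠ 0 := by exact_mod_cast M.factorial_ne_zero
  have hM1 : (M : ℂ) + 1 ≠ 0 := by exact_mod_cast M.succ_ne_zero
  have hpi : (Real.sqrt Real.pi : ℂ) ≠ 0 := by
    exact_mod_cast (Real.sqrt_pos.mpr Real.pi_pos).ne'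
  have hp : (2 : ℂ) ^ (1 - 2 * ((M : ℂ) + 1)) * 2 ^ (2 * M + 1) = 1 := by
    rw [← Complex.cpow_natCast, ← Complex.cpow_add _ _ two_ne_zero]
    push_cast
    rw [show 1 - 2 * ((M : ℂ) + 1) + (2 * M + 1) = 0 by ring, Complex.cpow_zero]
  rw [show 2 * ((M : ℂ) + 1) = M + 1 + (M + 1) by ring] at hd hp
  rw [Complex.Gamma_nat_eq_factorial] at hb hd
  rw [Nat.factorial_succ]
  push_cast
  generalize Complex.betaIntegral (M + 1) (M + 1) = B at *
  generalize Complex.Gamma ((M : ℂ) + 1 + (M + 1)) = G at *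
  generalize Complex.Gamma ((M : ℂ) + 1 + 1 / 2) = H at *
  generalize (2 : ℂ) ^ (1 - ((M : ℂ) + 1 + (M + 1))) = T at *
  generalize (Real.sqrt Real.pi : ℂ) = p at *
  field_simp
  apply mul_left_cancel₀ (mul_ne_zero hG hM)
  linear_combination 2 ^ (2 * M + 1) * G * B * hd + G * p * (G * B) * hp - G * p * hb

theorem gegenbauer_eq_ferrersP_sum (x : ℝ) (hx : x ∈ Set.Ioo (-1 : ℝ) 1)
    (n N : ℕ) (hN : 1 ≤ N) (hn : n ≤ 2 * N - 1) :
    gegenbauerC n (1 / 2 - (N : ℂ)) x =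
      (2 : ℂ) ^ ((N : ℂ) - 1) * Complex.Gamma ((N : ℂ) + 1 / 2) / (Real.sqrt Real.pi : ℂ) *
        ((1 - x ^ 2 : ℝ) : ℂ) ^ ((N : ℂ) / 2) *
        (ferrersP ((n : ℂ) - N) (N : ℂ) x + (-1) ^ n * ferrersP ((n : ℂ) - N) (N : ℂ) (-x)) := by
  obtain ⟨M, rfl⟩ := Nat.exists_eq_add_of_le' hN
  have h0 := gamma_mul_betaIntegral M
  rw [← ferrersPair_neg M ((1 - x) / 2)] at h0
  rw [gegenbauerC_eq_ferrersPair _ (by push_cast; ring) h0 n]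
  have hx' : -x ∈ Set.Ioo (-1 : ℝ) 1 := ⟨by linarith [hx.2], by linarith [hx.1]⟩
  have h1 := one_sub_sq_cpow_mul_ferrersP hx (M + 1) ((n : ℂ) - (M + 1 : ℕ))
  have h2 := one_sub_sq_cpow_mul_ferrersP hx' (M + 1) ((n : ℂ) - (M + 1 : ℕ))
  rw [neg_sq] at h2
  have e : (2 : ℂ) ^ (((M + 1 : ℕ) : ℂ) - 1) = 2 ^ M := by
    rw [← Complex.cpow_natCast]; push_cast; ring_nf
  rw [e, mul_assoc _ _ (_ + _), mul_add _ (ferrersP _ _ x), mul_left_comm _ ((-1) ^ n), h1, h2,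
    ferrersPair]
  have hy : (1 - ((-x : ℝ) : ℂ)) / 2 = 1 - (1 - x) / 2 := by push_cast; ring
  rw [hy]
  push_cast
  ring
end

section
/- Let x ∈ (−1,1) and n, k ∈ ℕ₀ with 2n+k ≥ 1. Then the Rodrigues-type formula 𝖰_{k+n−1/2}^{n−1/2}(x) = (π (−1)^{n+k} (2n+k−1)! / (2^{k+n+1/2} k! Γ(k+n+1/2) (1−x²)^{n/2−1/4})) · (d/dx)^k [ (1−x²)^{k+n−1/2} ] holds, where (d/dx)^k denotes the k-th derivative with respect to x. -/
/-- Ferrers function of the second kind `𝖰_ν^μ(x)`. -/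
noncomputable def ferrersQ (ν μ : ℂ) (x : ℝ) : ℂ :=
  ((Real.pi : ℂ) / (2 * Complex.sin ((Real.pi : ℂ) * μ))) *
    (Complex.cos ((Real.pi : ℂ) * μ) / Complex.Gamma (1 - μ) *
        (((1 + x) / (1 - x) : ℝ) : ℂ) ^ (μ / 2) *
        hyp2F1 (-ν) (ν + 1) (1 - μ) (((1 - x) / 2 : ℝ) : ℂ)
      - Complex.Gamma (ν + μ + 1) / (Complex.Gamma (ν - μ + 1) * Complex.Gamma (1 + μ)) *
        (((1 - x) / (1 + x) : ℝ) : ℂ) ^ (μ / 2) *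
        hyp2F1 (-ν) (ν + 1) (1 + μ) (((1 - x) / 2 : ℝ) : ℂ))

theorem summable_natCast_mul_and_hasDerivAt_tsum {c : ℕ → ℂ}
    (hc : ∀ z : ℂ, ‖z‖ < 1 → Summable fun j => c j * z ^ j) {z : ℂ} (hz : ‖z‖ < 1) :
    ∃ d, HasDerivAt (fun w : ℂ => ∑' j, c j * w ^ j) d z ∧
      HasSum (fun j : ℕ => (j : ℂ) * c j * z ^ j) (z * d) := by
  obtain ⟨r, hzr, hr1⟩ := exists_between hz
  have hr0 : 0 ≤ r := (norm_nonneg z).trans hzr.le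
  have hu : Summable fun j => ‖c j‖ * r ^ j := by
    have := (hc (r : ℂ) (by simpa [abs_of_nonneg hr0] using hr1)).norm
    simpa [abs_of_nonneg hr0] using this
  have hdiff : ∀ j : ℕ, DifferentiableOn ℂ (fun w : ℂ => c j * w ^ j) (Metric.ball 0 r) :=
    fun j => by fun_prop
  have hle : ∀ (j : ℕ) (w : ℂ), w ∈ Metric.ball (0 : ℂ) r → ‖c j * w ^ j‖ ≤ ‖c j‖ * r ^ j := by
    intro j w hw
    rw [norm_mul, norm_pow]
    have : ‖w‖ ≤ r := by simpa using (mem_ball_zero_iff.mp hw).le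
    gcongr
  have hzU : z ∈ Metric.ball (0 : ℂ) r := by simpa using hzr
  refine ⟨_, ((Complex.differentiableOn_tsum_of_summable_norm hu hdiff Metric.isOpen_ball
    hle).differentiableAt (Metric.isOpen_ball.mem_nhds hzU)).hasDerivAt, ?_⟩
  have key := (Complex.hasSum_deriv_of_summable_norm hu hdiff Metric.isOpen_ball hle hzU).mul_left z
  refine (funext fun j => ?_ : (fun j : ℕ => (j : ℂ) * c j * z ^ j) = _) ▸ key
  rw [((hasDerivAt_pow j z).const_mul (c j)).deriv]
  rcases j with _ | j
  · simp
  · simp only [Nat.add_sub_cancel]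
    ring

theorem summable_add_natCast_mul {c : ℕ → ℂ}
    (hc : ∀ z : ℂ, ‖z‖ < 1 → Summable fun j => c j * z ^ j) (a : ℂ) (z : ℂ) (hz : ‖z‖ < 1) :
    Summable fun j : ℕ => (a + j) * c j * z ^ j := by
  obtain ⟨d, -, hd⟩ := summable_natCast_mul_and_hasDerivAt_tsum hc hz
  refine (((hc z hz).mul_left a).add hd.summable).congr fun j => ?_
  ring

theorem hasDerivAt_cpow_mul_tsum {c : ℕ → ℂ}
    (hc : ∀ z : ℂ, ‖z‖ < 1 → Summable fun j => c j * z ^ j) (a : ℂ) {z : ℂ} (hz : ‖z‖ < 1)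
    (hz' : z ∈ Complex.slitPlane) :
    HasDerivAt (fun w : ℂ => w ^ a * ∑' j, c j * w ^ j)
      (z ^ (a - 1) * ∑' j : ℕ, (a + j) * c j * z ^ j) z := by
  obtain ⟨d, hd, hs⟩ := summable_natCast_mul_and_hasDerivAt_tsum hc hz
  have h0 : z ≠ 0 := Complex.slitPlane_ne_zero hz'
  have hsum : ∑' j : ℕ, (a + j) * c j * z ^ j = a * (∑' j, c j * z ^ j) + z * d := by
    rw [← hs.tsum_eq, ← tsum_mul_left, ← ((hc z hz).mul_left a).tsum_add hs.summable]
    exact tsum_congr fun j => by ring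
  have hpow : z ^ a = z ^ (a - 1) * z := by
    rw [Complex.cpow_sub _ _ h0, Complex.cpow_one, div_mul_cancel₀ _ h0]
  refine (((hasDerivAt_id z).cpow_const (c := a) hz').mul hd).congr_deriv ?_
  rw [hsum]
  simp only [id_eq]
  rw [hpow]
  ring

theorem ringChoose_add_sub_one_eq_cpoch_div (a : ℂ) (j : ℕ) :
    Ring.choose (a + j - 1) j = cpoch a j / (Nat.factorial j : ℂ) := by
  have h : ∀ j : ℕ, (ascPochhammer ℂ j).eval a = cpoch a j := by
    intro j
    induction j with
    | zero => simp [cpoch]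
    | succ j ih => rw [ascPochhammer_succ_eval, ih, cpoch, cpoch, Finset.prod_range_succ]
  rw [Ring.choose_eq_smul, Polynomial.descPochhammer_smeval_eq_ascPochhammer,
    Polynomial.ascPochhammer_smeval_cast, Polynomial.ascPochhammer_smeval_eq_eval,
    show a + (j : ℂ) - 1 - j + 1 = a by ring, h, smul_eq_mul]
  ring

theorem hasSum_one_sub_cpow (a : ℂ) {z : ℂ} (hz : ‖z‖ < 1) :
    HasSum (fun j : ℕ => cpoch (-a) j / (Nat.factorial j : ℂ) * z ^ j) ((1 - z) ^ a) := by
  have h := (Complex.one_div_one_sub_cpow_hasFPowerSeriesOnBall_zero (-a)).hasSum (y := z)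
    (by simpa [← ofReal_norm] using hz)
  simpa [Complex.cpow_neg, FormalMultilinearSeries.ofScalars,
    ringChoose_add_sub_one_eq_cpoch_div] using h

theorem cpoch_add (a : ℂ) (m n : ℕ) : cpoch a (m + n) = cpoch a m * cpoch (a + m) n := by
  simp only [cpoch, Finset.prod_range_add]
  congr 1
  exact Finset.prod_congr rfl fun i _ => by push_cast; ring

theorem cpoch_ne_zero {a : ℂ} (ha : 0 < a.re) (m : ℕ) : cpoch a m ≠ 0 := by
  refine Finset.prod_ne_zero_iff.mpr fun i _ h0 => ?_
  have := congrArg Complex.re h0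
  simp only [Complex.add_re, Complex.natCast_re, Complex.zero_re] at this
  have hi : (0 : ℝ) ≤ i := Nat.cast_nonneg i
  linarith

theorem Gamma_add_natCast_eq_cpoch_mul {a : ℂ} (ha : 0 < a.re) (m : ℕ) :
    Complex.Gamma (a + m) = cpoch a m * Complex.Gamma a := by
  induction m with
  | zero => simp [cpoch]
  | succ m ih =>
    have hne : a + m ≠ 0 := by
      intro h0
      have := congrArg Complex.re h0
      simp only [Complex.add_re, Complex.natCast_re, Complex.zero_re] at this
      have hi : (0 : ℝ) ≤ m := Nat.cast_nonneg m
      linarith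
    rw [show a + ((m + 1 : ℕ) : ℂ) = a + m + 1 by push_cast; ring, Complex.Gamma_add_one _ hne, ih,
      cpoch, cpoch, Finset.prod_range_succ]
    ring

/-- The coefficients `j ↦ rodriguesCoeff a i j` of the power series whose product with `z ^ (a - i)`
is the `i`-th derivative of `z ^ a * (1 - z) ^ a`. -/
noncomputable def rodriguesCoeff (a : ℂ) : ℕ → ℕ → ℂ
  | 0, j => cpoch (-a) j / (Nat.factorial j : ℂ)
  | i + 1, j => (a - i + j) * rodriguesCoeff a i j

theorem summable_rodriguesCoeff (a : ℂ) (i : ℕ) (z : ℂ) (hz : ‖z‖ < 1) :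
    Summable fun j => rodriguesCoeff a i j * z ^ j := by
  induction i generalizing z with
  | zero => exact (hasSum_one_sub_cpow a hz).summable
  | succ i ih => exact summable_add_natCast_mul ih (a - i) z hz

theorem rodriguesCoeff_eq (a : ℂ) (k j : ℕ) :
    rodriguesCoeff a k j = cpoch (-a) j / (Nat.factorial j : ℂ) * cpoch (a - k + 1 + j) k := by
  induction k with
  | zero => simp [rodriguesCoeff, cpoch]
  | succ k ih =>
    rw [rodriguesCoeff, ih, cpoch, cpoch, cpoch, Finset.prod_range_succ']
    have : ∀ i : ℕ, a - ((k + 1 : ℕ) : ℂ) + 1 + j + ((i + 1 : ℕ) : ℂ) = a - k + 1 + j + i := by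
      intro i; push_cast; ring
    simp only [this]
    push_cast
    ring

theorem iteratedDeriv_one_sub_sq_cpow (a : ℂ) (i : ℕ) {y : ℝ} (hy : y ∈ Set.Ioo (-1 : ℝ) 1) :
    iteratedDeriv i (fun y : ℝ => (1 - (y : ℂ) ^ 2) ^ a) y =
      4 ^ a * (-1 / 2) ^ i * ((((1 - y) / 2 : ℝ) : ℂ) ^ (a - i) *
        ∑' j, rodriguesCoeff a i j * (((1 - y) / 2 : ℝ) : ℂ) ^ j) := by
  have hnorm : ∀ y : ℝ, y ∈ Set.Ioo (-1 : ℝ) 1 → ‖(((1 - y) / 2 : ℝ) : ℂ)‖ < 1 := by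
    intro y hy
    rw [Complex.norm_real, Real.norm_eq_abs, abs_lt]
    constructor <;> linarith [hy.1, hy.2]
  induction i generalizing y with
  | zero =>
    have h1 : 0 ≤ (1 - y) / 2 := by linarith [hy.2]
    have h2 : 0 ≤ 1 - (1 - y) / 2 := by linarith [hy.1]
    have hsum : ∑' j, rodriguesCoeff a 0 j * (((1 - y) / 2 : ℝ) : ℂ) ^ j =
        ((1 - (1 - y) / 2 : ℝ) : ℂ) ^ a := by
      rw [Complex.ofReal_sub, Complex.ofReal_one]
      exact (hasSum_one_sub_cpow a (hnorm y hy)).tsum_eq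
    rw [hsum, iteratedDeriv_zero, pow_zero, mul_one, Nat.cast_zero, sub_zero,
      ← Complex.mul_cpow_ofReal_nonneg h1 h2, ← Complex.ofReal_mul]
    have h4 : (4 : ℂ) = ((4 : ℝ) : ℂ) := by norm_num
    rw [h4, ← Complex.mul_cpow_ofReal_nonneg (by norm_num) (mul_nonneg h1 h2)]
    congr 1
    push_cast
    ring
  | succ i ih =>
    rw [iteratedDeriv_succ]
    have hev : iteratedDeriv i (fun y : ℝ => (1 - (y : ℂ) ^ 2) ^ a) =ᶠ[nhds y]
        fun y => 4 ^ a * (-1 / 2) ^ i * ((((1 - y) / 2 : ℝ) : ℂ) ^ (a - i) *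
        ∑' j, rodriguesCoeff a i j * (((1 - y) / 2 : ℝ) : ℂ) ^ j) := by
      filter_upwards [isOpen_Ioo.mem_nhds hy] with t ht using ih ht
    rw [hev.deriv_eq]
    have hslit : (((1 - y) / 2 : ℝ) : ℂ) ∈ Complex.slitPlane := by
      rw [Complex.ofReal_mem_slitPlane]
      linarith [hy.2]
    have hin : HasDerivAt (fun t : ℝ => (((1 - t) / 2 : ℝ) : ℂ)) (-1 / 2) y := by
      have h := (((hasDerivAt_id y).const_sub 1).div_const 2).ofReal_comp
      simpa using h
    have h := ((hasDerivAt_cpow_mul_tsum (summable_rodriguesCoeff a i) (a - i) (hnorm y hy)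
      hslit).comp y hin).const_mul (4 ^ a * (-1 / 2) ^ i)
    refine h.deriv.trans ?_
    rw [show a - ((i + 1 : ℕ) : ℂ) = a - i - 1 by push_cast; ring]
    simp only [rodriguesCoeff]
    ring

theorem tsum_rodriguesCoeff {b : ℂ} (hb : 0 < (b + 1).re) (k : ℕ) (z : ℂ) :
    ∑' j, rodriguesCoeff (k + b) k j * z ^ j =
      cpoch (b + 1) k * hyp2F1 (-(k + b)) (k + b + 1) (b + 1) z := by
  rw [hyp2F1, ← tsum_mul_left]
  refine tsum_congr fun j => ?_
  have hj := cpoch_ne_zero hb j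
  have hf : (Nat.factorial j : ℂ) ≠ 0 := by exact_mod_cast Nat.factorial_ne_zero j
  have h := cpoch_add (b + 1) j k
  rw [add_comm j k, cpoch_add, show b + 1 + (k : ℂ) = k + b + 1 by ring] at h
  rw [rodriguesCoeff_eq, show (k : ℂ) + b - k + 1 + j = b + 1 + j by ring]
  field_simp
  linear_combination -(cpoch (-((k : ℂ) + b)) j * z ^ j) * h

theorem sin_pi_mul_natCast_sub_half (n : ℕ) :
    Complex.sin (Real.pi * ((n : ℂ) - 1 / 2)) = -(-1) ^ n := by
  rw [show (Real.pi : ℂ) * ((n : ℂ) - 1 / 2) = n * Real.pi - Real.pi / 2 by ring,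
    Complex.sin_sub_pi_div_two, ← Complex.ofReal_natCast, ← Complex.ofReal_mul,
    ← Complex.ofReal_cos, Real.cos_nat_mul_pi]
  push_cast
  rfl

theorem cos_pi_mul_natCast_sub_half (n : ℕ) :
    Complex.cos (Real.pi * ((n : ℂ) - 1 / 2)) = 0 := by
  rw [show (Real.pi : ℂ) * ((n : ℂ) - 1 / 2) = n * Real.pi - Real.pi / 2 by ring,
    Complex.cos_sub_pi_div_two, Complex.sin_nat_mul_pi]

theorem half_mul_cpow_div_eq {x : ℝ} (hx : x ∈ Set.Ioo (-1 : ℝ) 1) (k : ℕ) (b : ℂ) :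
    1 / 2 * (((1 - x) / (1 + x) : ℝ) : ℂ) ^ (b / 2) =
      4 ^ ((k : ℂ) + b) * (1 / 2) ^ k * (((1 - x) / 2 : ℝ) : ℂ) ^ b /
        (2 ^ ((k : ℂ) + b + 1) * ((1 - x ^ 2 : ℝ) : ℂ) ^ (b / 2)) := by
  have h1 : 0 < 1 - x := by linarith [hx.2]
  have h2 : 0 < 1 + x := by linarith [hx.1]
  have c1 : ((1 - x : ℝ) : ℂ) ≠ 0 := by exact_mod_cast h1.ne'
  have c2 : ((1 + x : ℝ) : ℂ) ≠ 0 := by exact_mod_cast h2.ne'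
  have hs : ((1 - x : ℝ) : ℂ) ^ b = (((1 - x : ℝ) : ℂ) ^ (b / 2)) ^ 2 := by
    rw [sq, ← Complex.cpow_add _ _ c1, add_halves]
  have hdiv : ∀ (u v : ℝ) (e : ℂ), 0 < u → 0 < v →
      ((u / v : ℝ) : ℂ) ^ e = (u : ℂ) ^ e / (v : ℂ) ^ e := by
    intro u v e hu hv
    have hv' : (v : ℂ) ≠ 0 := by exact_mod_cast hv.ne'
    rw [eq_div_iff (by simp [Complex.cpow_eq_zero_iff, hv']),
      ← Complex.mul_cpow_ofReal_nonneg (by positivity) hv.le, ← Complex.ofReal_mul,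
      div_mul_cancel₀ _ hv.ne']
  have h4 : (4 : ℂ) ^ ((k : ℂ) + b) = (2 ^ k * 2 ^ b) ^ 2 := by
    rw [show (4 : ℂ) = ((2 : ℝ) : ℂ) * ((2 : ℝ) : ℂ) by norm_num,
      Complex.mul_cpow_ofReal_nonneg (by norm_num) (by norm_num), ← sq]
    simp only [Complex.ofReal_ofNat]
    rw [Complex.cpow_add _ _ two_ne_zero, Complex.cpow_natCast]
  have h22 : (2 : ℂ) ^ ((k : ℂ) + b + 1) = 2 ^ k * 2 ^ b * 2 := by
    rw [Complex.cpow_add _ _ two_ne_zero, Complex.cpow_add _ _ two_ne_zero, Complex.cpow_natCast,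
      Complex.cpow_one]
  rw [hdiv _ _ _ h1 h2, hdiv _ _ _ h1 two_pos, hs, h4, h22,
    show 1 - x ^ 2 = (1 - x) * (1 + x) by ring, Complex.ofReal_mul,
    Complex.mul_cpow_ofReal_nonneg h1.le h2.le, Complex.ofReal_ofNat]
  have e1 : ((1 - x : ℝ) : ℂ) ^ (b / 2) ≠ 0 := by
    simp only [ne_eq, Complex.cpow_eq_zero_iff, c1, false_and, not_false_eq_true]
  have e2 : ((1 + x : ℝ) : ℂ) ^ (b / 2) ≠ 0 := by
    simp only [ne_eq, Complex.cpow_eq_zero_iff, c2, false_and, not_false_eq_true]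
  have e3 : (2 : ℂ) ^ b ≠ 0 := by simp [Complex.cpow_eq_zero_iff]
  generalize ((1 - x : ℝ) : ℂ) ^ (b / 2) = s at *
  generalize ((1 + x : ℝ) : ℂ) ^ (b / 2) = p at *
  generalize (2 : ℂ) ^ b = E at *
  rw [div_pow, one_pow]
  field_simp

theorem ferrersQ_rodrigues (x : ℝ) (hx : x ∈ Set.Ioo (-1 : ℝ) 1) (n k : ℕ)
    (h : 1 ≤ 2 * n + k) :
    ferrersQ ((k : ℂ) + n - 1 / 2) ((n : ℂ) - 1 / 2) x =
      (Real.pi : ℂ) * (-1) ^ (n + k) * (Nat.factorial (2 * n + k - 1) : ℂ) /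
          ((2 : ℂ) ^ ((k : ℂ) + n + 1 / 2) * (Nat.factorial k : ℂ) *
            Complex.Gamma ((k : ℂ) + n + 1 / 2) *
            ((1 - x ^ 2 : ℝ) : ℂ) ^ ((n : ℂ) / 2 - 1 / 4)) *
        iteratedDeriv k (fun y : ℝ => (1 - (y : ℂ) ^ 2) ^ ((k : ℂ) + n - 1 / 2)) x := by
  set b : ℂ := (n : ℂ) - 1 / 2 with hb
  have hre : 0 < (b + 1).re := by
    have : b + 1 = (((n : ℝ) + 1 / 2 : ℝ) : ℂ) := by rw [hb]; push_cast; ring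
    rw [this, Complex.ofReal_re]
    positivity
  rw [show (k : ℂ) + n - 1 / 2 = k + b by rw [hb]; ring,
    show (k : ℂ) + n + 1 / 2 = k + b + 1 by rw [hb]; ring,
    show (n : ℂ) / 2 - 1 / 4 = b / 2 by rw [hb]; ring,
    iteratedDeriv_one_sub_sq_cpow _ _ hx, tsum_rodriguesCoeff hre,
    show (k : ℂ) + b - k = b by ring, ferrersQ, cos_pi_mul_natCast_sub_half,
    sin_pi_mul_natCast_sub_half, show (k : ℂ) + b + b + 1 = ((2 * n + k - 1 : ℕ) : ℂ) + 1 by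
      rw [Nat.cast_sub h, hb]; push_cast; ring,
    Complex.Gamma_nat_eq_factorial, show (k : ℂ) + b - b + 1 = k + 1 by ring,
    Complex.Gamma_nat_eq_factorial, add_comm 1 b, zero_div, zero_mul, zero_mul, zero_sub]
  have hG : Complex.Gamma (k + b + 1) = cpoch (b + 1) k * Complex.Gamma (b + 1) := by
    rw [← Gamma_add_natCast_eq_cpoch_mul hre]
    congr 1
    ring
  have hpow := half_mul_cpow_div_eq hx k b
  have hG0 : Complex.Gamma (b + 1) ≠ 0 := Complex.Gamma_ne_zero_of_re_pos hre
  have hp0 := cpoch_ne_zero hre k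
  have hk0 : (Nat.factorial k : ℂ) ≠ 0 := by exact_mod_cast Nat.factorial_ne_zero k
  rw [hG]
  generalize hyp2F1 _ _ _ _ = H at *
  have hsgn : (-1 : ℂ) ^ (n + k) * (-1 / 2) ^ k = (-1) ^ n * (1 / 2) ^ k := by
    rw [pow_add, mul_assoc, ← mul_pow]
    norm_num
  have hinv : ((-1 : ℂ) ^ n)⁻¹ = (-1) ^ n := by
    rw [← inv_pow]
    norm_num
  generalize (Nat.factorial (2 * n + k - 1) : ℂ) = M at *
  calc _ = (Real.pi : ℂ) * (((-1 : ℂ) ^ n)⁻¹) * (M / (Nat.factorial k * Complex.Gamma (b + 1))) *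
        (1 / 2 * (((1 - x) / (1 + x) : ℝ) : ℂ) ^ (b / 2)) * H := by
        field_simp
    _ = _ := by
        rw [hinv, hpow]
        generalize ((1 - x ^ 2 : ℝ) : ℂ) ^ (b / 2) = W
        generalize (2 : ℂ) ^ ((k : ℂ) + b + 1) = T
        calc _ = ((-1) ^ n * (1 / 2) ^ k) * ((Real.pi : ℂ) * M / (Nat.factorial k *
              Complex.Gamma (b + 1)) * (4 ^ ((k : ℂ) + b) * (((1 - x) / 2 : ℝ) : ℂ) ^ b /
              (T * W)) * H) := by ring
          _ = _ := by
              rw [← hsgn]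
              field_simp
end
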